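/- Let N ∈ ℕ_+, let 0 ≤ i < j < N, and let n ∈ ℕ_+ with ⟨n⟩ > j. Then for every x ∈ I_N^{i,j} and every t ∈ I_N, one has K_n(x − t) = 0. Consequently, if a : G_m → ℂ is bounded measurable with support contained in I_N and ∫_{G_m} a dμ = 0, then σ_n a(x) = 0 for every x ∈ I_N^{i,j}. -/

import Mathlib

open MeasureTheory Finset

noncomputable section

namespace Vilenkin

instance (n : ℕ) : MeasurableSpace (ZMod n) := ⊤

abbrev G (m : ℕ → ℕ) : Type := ∀ k, ZMod (m k)

def M (m : ℕ → ℕ) : ℕ → ℕ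
  | 0 => 1
  | k + 1 => m k * M m k

def digit (m : ℕ → ℕ) (n k : ℕ) : ℕ := (n / M m k) % m k

def rad (m : ℕ → ℕ) (k : ℕ) (x : G m) : ℂ :=
  Complex.exp (2 * (Real.pi : ℂ) * Complex.I * ((x k).val : ℂ) / (m k : ℂ))

def psi (m : ℕ → ℕ) (n : ℕ) (x : G m) : ℂ :=
  ∏ k ∈ Finset.range (n + 1), rad m k x ^ digit m n k

def D (m : ℕ → ℕ) (n : ℕ) (x : G m) : ℂ := ∑ k ∈ Finset.range n, psi m k x

def K (m : ℕ → ℕ) (n : ℕ) (x : G m) : ℂ := (n : ℂ)⁻¹ * ∑ k ∈ Finset.range n, D m k x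

def cyl (m : ℕ → ℕ) (n : ℕ) (x : G m) : Set (G m) := {y | ∀ j < n, y j = x j}

def e (m : ℕ → ℕ) (k : ℕ) : G m := fun j => if j = k then 1 else 0

def lo (m : ℕ → ℕ) (n : ℕ) : ℕ := sInf {j | digit m n j ≠ 0}

def hi (m : ℕ → ℕ) (n : ℕ) : ℕ := sSup {j | digit m n j ≠ 0}

def Iij (m : ℕ → ℕ) (N i j : ℕ) : Set (G m) :=
  if j = N then {x | x i ≠ 0 ∧ ∀ t < N, t ≠ i → x t = 0}
  else {x | (∀ t < i, x t = 0) ∧ x i ≠ 0 ∧ (∀ t, i < t → t < j → x t = 0) ∧ x j ≠ 0}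

def IsVilenkinMeasure (m : ℕ → ℕ) (μ : Measure (G m)) : Prop :=
  IsProbabilityMeasure μ ∧ ∀ (n : ℕ) (x : G m), μ (cyl m n x) = (M m n : ENNReal)⁻¹

def fhat (m : ℕ → ℕ) (μ : Measure (G m)) (f : G m → ℂ) (k : ℕ) : ℂ :=
  ∫ x, f x * (starRingEnd ℂ) (psi m k x) ∂μ

def S (m : ℕ → ℕ) (μ : Measure (G m)) (f : G m → ℂ) (n : ℕ) (x : G m) : ℂ :=
  ∑ k ∈ Finset.range n, fhat m μ f k * psi m k x

def sigma (m : ℕ → ℕ) (μ : Measure (G m)) (f : G m → ℂ) (n : ℕ) (x : G m) : ℂ :=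
  (n : ℂ)⁻¹ * ∑ k ∈ Finset.range n, S m μ f k x

end Vilenkin

open Vilenkin

namespace Vilenkin

variable {m : ℕ → ℕ}

lemma M_pos (hm : ∀ k, 2 ≤ m k) (k : ℕ) : 0 < M m k := by
  induction k with
  | zero => simp [M]
  | succ k ih => exact Nat.mul_pos (by linarith [hm k]) ih

lemma M_dvd_M {a b : ℕ} (h : a ≤ b) : M m a ∣ M m b := by
  induction b, h using Nat.le_induction with
  | base => rfl
  | succ b _ ih => exact ih.trans (Dvd.intro_left _ rfl)

lemma M_mono (hm : ∀ k, 2 ≤ m k) {a b : ℕ} (h : a ≤ b) : M m a ≤ M m b :=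
  Nat.le_of_dvd (M_pos hm b) (M_dvd_M h)

lemma lt_M (hm : ∀ k, 2 ≤ m k) (n : ℕ) : n < M m n := by
  induction n with
  | zero => simp [M]
  | succ n ih =>
    have := Nat.mul_le_mul_right (M m n) (hm n)
    simp only [M]
    omega

lemma digit_eq_zero_of_lt (hm : ∀ k, 2 ≤ m k) {n j k : ℕ} (hn : n < M m j) (hjk : j ≤ k) :
    digit m n k = 0 := by
  simp [digit, Nat.div_eq_of_lt (hn.trans_le (M_mono hm hjk))]

lemma digit_mul_add_of_lt (hm : ∀ k, 2 ≤ m k) {j k : ℕ} (s r : ℕ) (hkj : k < j) :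
    digit m (s * M m j + r) k = digit m r k := by
  obtain ⟨c, hc⟩ := M_dvd_M (m := m) (Nat.succ_le_of_lt hkj)
  have : s * M m j + r = r + M m k * (m k * (s * c)) := by
    rw [hc]; simp only [M]; ring
  rw [digit, digit, this, Nat.add_mul_div_left _ _ (M_pos hm k), Nat.add_mul_mod_self_left]

lemma digit_mul_add_of_le (hm : ∀ k, 2 ≤ m k) {j k : ℕ} (s : ℕ) {r : ℕ} (hr : r < M m j)
    (hjk : j ≤ k) : digit m (s * M m j + r) k = digit m (s * M m j) k := by
  obtain ⟨c, hc⟩ := M_dvd_M (m := m) hjk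
  have hp := M_pos hm j
  rw [digit, digit, hc, ← Nat.div_div_eq_div_mul, ← Nat.div_div_eq_div_mul, mul_comm s,
    Nat.mul_add_div hp, Nat.div_eq_of_lt hr, Nat.mul_div_cancel_left _ hp, add_zero]

lemma digit_mul_of_lt (hm : ∀ k, 2 ≤ m k) {j k : ℕ} (s : ℕ) (hkj : k < j) :
    digit m (s * M m j) k = 0 := by
  have := digit_mul_add_of_lt hm s 0 hkj
  simpa [digit] using this

lemma digit_mul_add (hm : ∀ k, 2 ≤ m k) {j : ℕ} (s : ℕ) {r : ℕ} (hr : r < M m j) (k : ℕ) :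
    digit m (s * M m j + r) k = digit m (s * M m j) k + digit m r k := by
  rcases lt_or_ge k j with h | h
  · rw [digit_mul_add_of_lt hm s r h, digit_mul_of_lt hm s h, zero_add]
  · rw [digit_mul_add_of_le hm s hr h, digit_eq_zero_of_lt hm hr h, add_zero]

lemma M_dvd_of_digit_eq_zero (n j : ℕ) (h : ∀ k < j, digit m n k = 0) : M m j ∣ n := by
  induction j with
  | zero => simp [M]
  | succ j ih =>
    obtain ⟨c, hc⟩ := ih fun k hk => h k (hk.trans j.lt_succ_self)
    rcases Nat.eq_zero_or_pos (M m j) with h0 | hp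
    · simp [hc, h0]
    have hd := h j j.lt_succ_self
    rw [digit, hc, Nat.mul_div_cancel_left _ hp] at hd
    rw [hc, M, mul_comm (m j)]
    exact Nat.mul_dvd_mul_left _ (Nat.dvd_of_mod_eq_zero hd)

lemma psi_eq_prod_range (hm : ∀ k, 2 ≤ m k) {n L : ℕ} (hn : n < M m L) (x : G m) :
    psi m n x = ∏ k ∈ range L, rad m k x ^ digit m n k := by
  have aux : ∀ L', n < M m L' → ∀ B, L' ≤ B → ∏ k ∈ range B, rad m k x ^ digit m n k =
      ∏ k ∈ range L', rad m k x ^ digit m n k := fun L' h' B hB => by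
    refine (prod_subset (range_subset_range.2 hB) fun k _ hk => ?_).symm
    rw [digit_eq_zero_of_lt hm h' (by simpa using hk), pow_zero]
  have hn' : n < M m (n + 1) := (lt_M hm n).trans_le (M_mono hm n.le_succ)
  rw [psi, ← aux (n + 1) hn' _ (le_max_left _ L), aux L hn _ (le_max_right _ _)]

lemma psi_mul_add (hm : ∀ k, 2 ≤ m k) {j : ℕ} (s : ℕ) {r : ℕ} (hr : r < M m j) (x : G m) :
    psi m (s * M m j + r) x = psi m (s * M m j) x * psi m r x := by
  set n := s * M m j + r with hn
  have h1 : n < M m n := lt_M hm n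
  rw [psi_eq_prod_range hm h1, psi_eq_prod_range hm (n := s * M m j) (L := n) (by omega),
    psi_eq_prod_range hm (n := r) (L := n) (by omega), ← prod_mul_distrib]
  exact prod_congr rfl fun k _ => by rw [hn, digit_mul_add hm s hr, pow_add]

lemma psi_mul_M (hm : ∀ k, 2 ≤ m k) {j s : ℕ} (hs : s < m j) (x : G m) :
    psi m (s * M m j) x = rad m j x ^ s := by
  have hp := M_pos hm j
  rw [psi_eq_prod_range hm (L := j + 1) (Nat.mul_lt_mul_of_pos_right hs hp), prod_range_succ,
    prod_eq_one fun k hk => by rw [digit_mul_of_lt hm s (mem_range.1 hk), pow_zero], one_mul,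
    digit, Nat.mul_div_cancel _ hp, Nat.mod_eq_of_lt hs]

lemma rad_eq_stdAddChar (k : ℕ) [NeZero (m k)] (x : G m) :
    rad m k x = ZMod.stdAddChar (x k) := by
  rw [ZMod.stdAddChar_apply, ZMod.toCircle_apply, rad]

lemma rad_sub (hm : ∀ k, 2 ≤ m k) (k : ℕ) (x t : G m) :
    rad m k (x - t) = rad m k x * (starRingEnd ℂ) (rad m k t) := by
  have : NeZero (m k) := ⟨by linarith [hm k]⟩
  rw [rad_eq_stdAddChar, rad_eq_stdAddChar, rad_eq_stdAddChar, Pi.sub_apply, sub_eq_add_neg,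
    AddChar.map_add_eq_mul, AddChar.map_neg_eq_conj]

lemma psi_sub (hm : ∀ k, 2 ≤ m k) (n : ℕ) (x t : G m) :
    psi m n (x - t) = psi m n x * (starRingEnd ℂ) (psi m n t) := by
  simp only [psi, map_prod, ← prod_mul_distrib, rad_sub hm, mul_pow, map_pow]

lemma sum_psi_mul_M_eq_zero (hm : ∀ k, 2 ≤ m k) {j : ℕ} {x : G m} (hx : x j ≠ 0) :
    ∑ s ∈ range (m j), psi m (s * M m j) x = 0 := by
  have : NeZero (m j) := ⟨by linarith [hm j]⟩
  rw [sum_congr rfl fun s hs => psi_mul_M hm (mem_range.1 hs) x]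
  have h1 : rad m j x ≠ 1 := by
    rw [rad_eq_stdAddChar, ← AddChar.map_zero_eq_one (ZMod.stdAddChar (N := m j))]
    exact fun h => hx (ZMod.injective_stdAddChar h)
  have hpow : rad m j x ^ m j = 1 := by
    rw [rad_eq_stdAddChar, ← AddChar.map_nsmul_eq_pow]
    simp
  rw [geom_sum_eq h1, hpow, sub_self, zero_div]

lemma D_mul_add (hm : ∀ k, 2 ≤ m k) {j : ℕ} (c : ℕ) {r : ℕ} (hr : r ≤ M m j) (x : G m) :
    D m (c * M m j + r) x = D m (c * M m j) x + psi m (c * M m j) x * D m r x := by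
  rw [D, sum_range_add, ← D, D, D, mul_sum]
  congr 1
  exact sum_congr rfl fun l hl => psi_mul_add hm c ((mem_range.1 hl).trans_le hr) x

lemma D_mul_M (hm : ∀ k, 2 ≤ m k) (j c : ℕ) (x : G m) :
    D m (c * M m j) x = (∑ s ∈ range c, psi m (s * M m j) x) * D m (M m j) x := by
  induction c with
  | zero => simp [D]
  | succ c ih => rw [add_one_mul, D_mul_add hm c le_rfl, ih, sum_range_succ, add_mul]

lemma sum_D_mul_M (hm : ∀ k, 2 ≤ m k) {j : ℕ} (c : ℕ) {x : G m} (hD : D m (M m j) x = 0) :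
    ∑ k ∈ range (c * M m j), D m k x =
      (∑ s ∈ range c, psi m (s * M m j) x) * ∑ k ∈ range (M m j), D m k x := by
  induction c with
  | zero => simp
  | succ c ih =>
    rw [add_one_mul, sum_range_add, ih, sum_range_succ, add_mul, mul_sum _ _ (psi m _ x)]
    congr 1
    refine sum_congr rfl fun r hr => ?_
    rw [D_mul_add hm c (mem_range.1 hr).le, D_mul_M hm, hD, mul_zero, zero_add]

lemma D_M_eq_zero (hm : ∀ k, 2 ≤ m k) {i j : ℕ} (hij : i < j) {x : G m} (hx : x i ≠ 0) :
    D m (M m j) x = 0 := by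
  obtain ⟨c, hc⟩ := M_dvd_M (m := m) (Nat.succ_le_of_lt hij)
  rw [hc, mul_comm, D_mul_M hm, Nat.succ_eq_add_one, M, D_mul_M hm, sum_psi_mul_M_eq_zero hm hx,
    zero_mul, mul_zero]

/-- The Fejér kernel `K_n` vanishes wherever two coordinates below the lowest nonzero digit of `n`
are nonzero. -/
lemma K_eq_zero (hm : ∀ k, 2 ≤ m k) {i j n : ℕ} (hij : i < j) (hn : M m (j + 1) ∣ n) {x : G m}
    (hi : x i ≠ 0) (hj : x j ≠ 0) : K m n x = 0 := by
  obtain ⟨c, rfl⟩ := hn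
  rw [K, mul_comm (M m (j + 1)), sum_D_mul_M hm c (D_M_eq_zero hm (hij.trans j.lt_succ_self) hi),
    M, sum_D_mul_M hm _ (D_M_eq_zero hm hij hi), sum_psi_mul_M_eq_zero hm hj]
  simp

lemma measurable_psi (n : ℕ) : Measurable (psi m n) := by
  refine Finset.measurable_prod _ fun k _ => Measurable.pow_const ?_ _
  have h : Measurable fun z : ZMod (m k) =>
      Complex.exp (2 * (Real.pi : ℂ) * Complex.I * (z.val : ℂ) / (m k : ℂ)) := measurable_from_top
  exact h.comp (measurable_pi_apply k)

lemma norm_psi (hm : ∀ k, 2 ≤ m k) (n : ℕ) (x : G m) : ‖psi m n x‖ = 1 := by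
  rw [psi, norm_prod]
  refine prod_eq_one fun k _ => ?_
  have : NeZero (m k) := ⟨by linarith [hm k]⟩
  rw [norm_pow, rad_eq_stdAddChar, AddChar.norm_apply, one_pow]

lemma fhat_mul_psi (hm : ∀ k, 2 ≤ m k) (μ : Measure (G m)) (f : G m → ℂ) (k : ℕ) (x : G m) :
    fhat m μ f k * psi m k x = ∫ t, f t * psi m k (x - t) ∂μ := by
  rw [fhat, ← integral_mul_const]
  exact integral_congr_ae (.of_forall fun t => by simp only [psi_sub hm]; ring)

lemma integrable_mul_psi_sub (hm : ∀ k, 2 ≤ m k) {μ : Measure (G m)} {f : G m → ℂ}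
    (hf : Integrable f μ) (k : ℕ) (x : G m) : Integrable (fun t => f t * psi m k (x - t)) μ := by
  refine hf.mul_bdd (c := 1) ?_ (.of_forall fun t => (norm_psi hm k _).le)
  simp only [psi_sub hm]
  exact (((Complex.continuous_conj.measurable.comp (measurable_psi k)).const_mul
    _)).aestronglyMeasurable

lemma sigma_eq_integral (hm : ∀ k, 2 ≤ m k) {μ : Measure (G m)} {f : G m → ℂ}
    (hf : Integrable f μ) (n : ℕ) (x : G m) :
    sigma m μ f n x = ∫ t, f t * K m n (x - t) ∂μ := by
  have hI : ∀ l, Integrable (fun t => f t * ((n : ℂ)⁻¹ * psi m l (x - t))) μ := fun l => by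
    simpa only [mul_left_comm] using (integrable_mul_psi_sub hm hf l x).const_mul (n : ℂ)⁻¹
  simp only [sigma, S, fhat_mul_psi hm, K, D, mul_sum]
  rw [integral_finsetSum _ fun k _ => integrable_finsetSum _ fun l _ => hI l]
  refine sum_congr rfl fun k _ => ?_
  rw [integral_finsetSum _ fun l _ => hI l]
  refine sum_congr rfl fun l _ => ?_
  rw [← integral_const_mul]
  simp only [mul_left_comm]

end Vilenkin

theorem statement16 (m : ℕ → ℕ) (hm : ∀ k, 2 ≤ m k)
    (N i j : ℕ) (hN : 1 ≤ N) (hij : i < j) (hjN : j < N)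
    (n : ℕ) (hn : 1 ≤ n) (hlo : j < lo m n) :
    (∀ x ∈ Iij m N i j, ∀ t ∈ cyl m N 0, K m n (x - t) = 0) ∧
    (∀ (μ : Measure (G m)), IsVilenkinMeasure m μ →
      ∀ a : G m → ℂ, Measurable a → (∃ C : ℝ, ∀ x, ‖a x‖ ≤ C) →
      (∀ x, x ∉ cyl m N 0 → a x = 0) → (∫ x, a x ∂μ) = 0 →
      ∀ x ∈ Iij m N i j, sigma m μ a n x = 0) := by
  have hdvd : M m (j + 1) ∣ n := M_dvd_of_digit_eq_zero n _ fun k hk => by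
    by_contra h
    have : lo m n ≤ k := Nat.sInf_le h
    omega
  have hK : ∀ x ∈ Iij m N i j, ∀ t ∈ cyl m N 0, K m n (x - t) = 0 := by
    intro x hx t ht
    rw [Iij, if_neg hjN.ne] at hx
    have hti : t i = 0 := ht i (hij.trans hjN)
    have htj : t j = 0 := ht j hjN
    exact K_eq_zero hm hij hdvd (by simpa [hti] using hx.2.1) (by simpa [htj] using hx.2.2.2)
  refine ⟨hK, fun μ hμ a ha ⟨C, hC⟩ hsupp _ x hx => ?_⟩
  have := hμ.1
  rw [sigma_eq_integral hm (.of_bound ha.aestronglyMeasurable C (.of_forall hC))]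
  refine integral_eq_zero_of_ae (.of_forall fun t => ?_)
  by_cases ht : t ∈ cyl m N 0
  · simp [hK x hx t ht]
  · simp [hsupp t ht]
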